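/- arXiv:2212.14420 — 2 statements merged into one kernel-verified Lean document; each statement's English description precedes it below -/
import Mathlib

section
/- Let (S, f) be a lifted partial permutation on k letters and ⟨i, j⟩ a crossing of (S, f). Then cross(f_{⟨i,j⟩}) ≤ cross(f) − 1. -/
open scoped Classical BigOperators

noncomputable section

/-- The group `G_m` of bijections of `ℤ` generated by the reflections
`x ↦ 1 - x` (about `1/2`) and `x ↦ 2m - 1 - x` (about `m - 1/2`). -/
def Gm (m : ℕ) : Subgroup (Equiv.Perm ℤ) :=
  Subgroup.closure {Equiv.subLeft (1 : ℤ), Equiv.subLeft (2 * (m : ℤ) - 1)}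

/-- `y` lies in the `G_m`-orbit of `x`. -/
def GmRel (m : ℕ) (x y : ℤ) : Prop := ∃ g ∈ Gm m, g x = y

/-- The `G_m`-orbit of an integer. -/
def GmOrbit (m : ℕ) (x : ℤ) : Set ℤ := {y | GmRel m x y}

/-- `(S, f)` is a lifted partial permutation on `k` letters: `S` is a
`G_m`-invariant subset of `ℤ`, `f` is `G_m`-equivariant on `S`, the quotient
`S/G_m` has exactly `k` elements, and the induced map `S/G_m → ℤ/G_m` is
injective.  (The values of `f` off `S` are irrelevant.) -/
structure IsLPP (m k : ℕ) (S : Set ℤ) (f : ℤ → ℤ) : Prop where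
  invariant : ∀ g ∈ Gm m, ∀ x ∈ S, g x ∈ S
  equivariant : ∀ g ∈ Gm m, ∀ x ∈ S, f (g x) = g (f x)
  orbits : (GmOrbit m '' S).ncard = k
  inj : ∀ x ∈ S, ∀ y ∈ S, GmRel m (f x) (f y) → GmRel m x y

/-- `(i, j)` is a crossing pair for `(S, f)`. -/
def IsCrossing (S : Set ℤ) (f : ℤ → ℤ) (i j : ℤ) : Prop :=
  i ∈ S ∧ j ∈ S ∧ i < j ∧ f j < f i

/-- The `G_m`-orbit of the unordered pair `{p.1, p.2}`; two pairs are
equivalent exactly when they have the same `pairOrbit`. -/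
def pairOrbit (m : ℕ) (p : ℤ × ℤ) : Set (Set ℤ) :=
  {A | ∃ g ∈ Gm m, A = {g p.1, g p.2}}

/-- The set of crossings of `(S, f)` (equivalence classes of crossing pairs). -/
def crossings (m : ℕ) (S : Set ℤ) (f : ℤ → ℤ) : Set (Set (Set ℤ)) :=
  pairOrbit m '' {p : ℤ × ℤ | IsCrossing S f p.1 p.2}

/-- The number of crossings `cross(f)`. -/
def crossCount (m : ℕ) (S : Set ℤ) (f : ℤ → ℤ) : ℕ := (crossings m S f).ncard

/-- The set whose cardinality (halved) is the weight `w_j(S, f)`. -/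
def weightSet (j : ℤ) (S : Set ℤ) (f : ℤ → ℤ) : Set ℤ :=
  {i | i ∈ S ∧ (((i : ℚ) < (j : ℚ) - 1/2 ∧ (j : ℚ) - 1/2 < (f i : ℚ)) ∨
    ((f i : ℚ) < (j : ℚ) - 1/2 ∧ (j : ℚ) - 1/2 < (i : ℚ)))}

/-- The weight `w_j(S, f)`. -/
def weight (j : ℤ) (S : Set ℤ) (f : ℤ → ℤ) : ℚ := (weightSet j S f).ncard / 2

/-- The resolution `f_{⟨i,j⟩}` of `f` at the crossing `⟨i, j⟩`. -/
def resolveFun (m : ℕ) (f : ℤ → ℤ) (i j : ℤ) : ℤ → ℤ := fun x =>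
  if h : ∃ g ∈ Gm m, g i = x then h.choose (f j)
  else if h' : ∃ g ∈ Gm m, g j = x then h'.choose (f i)
  else f x

/-- The graph `Γ_f = {(i, f i) : i ∈ S}`. -/
def graphOf (S : Set ℤ) (f : ℤ → ℤ) : Set (ℤ × ℤ) :=
  {p | p.1 ∈ S ∧ p.2 = f p.1}

/-- The `G_m`-orbit of a point of `ℤ × ℤ` under the diagonal action. -/
def GmOrbit2 (m : ℕ) (p : ℤ × ℤ) : Set (ℤ × ℤ) :=
  {q | ∃ g ∈ Gm m, (g p.1, g p.2) = q}

/-- The left endpoint of the image of the unit interval `[a, a+1]` under the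
affine extension of `g` to `ℝ`. -/
def sqIdx (g : Equiv.Perm ℤ) (a : ℤ) : ℤ := min (g a) (g (a + 1))

/-- The `G_m`-orbit of it the unit square indexed by `p`. -/
def sqOrbit (m : ℕ) (p : ℤ × ℤ) : Set (ℤ × ℤ) :=
  {q | ∃ g ∈ Gm m, (sqIdx g p.1, sqIdx g p.2) = q}

/-- `D` is a domain from `(S, f)` to `(T, g)`: a `G_m`-invariant assignment of
multiplicities to unit squares, nonzero on finitely many `G_m`-orbits of
squares, whose corners are governed by the two graphs. -/
def IsHDomain (m : ℕ) (S : Set ℤ) (f : ℤ → ℤ) (T : Set ℤ) (g : ℤ → ℤ)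
    (D : ℤ × ℤ → ℤ) : Prop :=
  (∀ γ ∈ Gm m, ∀ a b : ℤ, D (sqIdx γ a, sqIdx γ b) = D (a, b)) ∧
  (sqOrbit m '' {p : ℤ × ℤ | D p ≠ 0}).Finite ∧
  (∀ i j : ℤ,
    D (i, j) + D (i - 1, j - 1) - D (i, j - 1) - D (i - 1, j) =
      (if (i, j) ∈ graphOf T g then 1 else 0) -
        (if (i, j) ∈ graphOf S f then 1 else 0))

/-- Elements of `G_m` are even translations or reflections about half-integers. -/
lemma Gm_classify {m : ℕ} {g : Equiv.Perm ℤ} (hg : g ∈ Gm m) :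
    ∃ t : ℤ, (∀ x, g x = x + 2 * t) ∨ (∀ x, g x = 1 + 2 * t - x) := by
  induction hg using Subgroup.closure_induction with
  | mem g hg =>
    rcases hg with rfl | rfl
    · exact ⟨0, Or.inr fun x => by simp⟩
    · exact ⟨m - 1, Or.inr fun x => by simp; ring⟩
  | one => exact ⟨0, Or.inl fun x => by simp⟩
  | mul g g' _ _ ihg ihg' =>
    obtain ⟨t, ht⟩ := ihg
    obtain ⟨u, hu⟩ := ihg'
    rcases ht with ht | ht <;> rcases hu with hu | hu
    · exact ⟨t + u, Or.inl fun x => by simp only [Equiv.Perm.mul_apply, ht, hu]; ring⟩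
    · exact ⟨t + u, Or.inr fun x => by simp only [Equiv.Perm.mul_apply, ht, hu]; ring⟩
    · exact ⟨t - u, Or.inr fun x => by simp only [Equiv.Perm.mul_apply, ht, hu]; ring⟩
    · exact ⟨t - u, Or.inl fun x => by simp only [Equiv.Perm.mul_apply, ht, hu]; ring⟩
  | inv g _ ih =>
    obtain ⟨t, ht | ht⟩ := ih
    · exact ⟨-t, Or.inl fun x => by rw [Equiv.Perm.inv_eq_iff_eq, ht]; ring⟩
    · exact ⟨t, Or.inr fun x => by rw [Equiv.Perm.inv_eq_iff_eq, ht]; ring⟩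

/-- `G_m` acts freely on `ℤ`. -/
lemma Gm_eq_of_apply_eq {m : ℕ} {g g' : Equiv.Perm ℤ} (hg : g ∈ Gm m) (hg' : g' ∈ Gm m)
    {x : ℤ} (h : g x = g' x) : g = g' := by
  obtain ⟨t, ht | ht⟩ := Gm_classify hg <;> obtain ⟨u, hu | hu⟩ := Gm_classify hg' <;>
    (rw [ht, hu] at h; ext y; rw [ht, hu]; omega)

lemma exists_mem_Gm_apply_eq_add (m : ℕ) (n : ℤ) :
    ∃ g ∈ Gm m, ∀ x, g x = x + n * (2 * m - 2) := by
  have hmem : Equiv.subLeft (2 * (m : ℤ) - 1) * Equiv.subLeft (1 : ℤ) ∈ Gm m :=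
    mul_mem (Subgroup.subset_closure (by simp)) (Subgroup.subset_closure (by simp))
  have heq : Equiv.subLeft (2 * (m : ℤ) - 1) * Equiv.subLeft (1 : ℤ)
      = Equiv.addRight (2 * (m : ℤ) - 2) := by
    ext x
    simp
    ring
  rw [heq] at hmem
  exact ⟨_, zpow_mem hmem n, fun x => by simp⟩

lemma pairOrbit_eq_of_mem {m : ℕ} {g : Equiv.Perm ℤ} (hg : g ∈ Gm m) (a b : ℤ) :
    pairOrbit m (g a, g b) = pairOrbit m (a, b) := by
  ext A
  constructor
  · rintro ⟨u, hu, rfl⟩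
    exact ⟨u * g, mul_mem hu hg, rfl⟩
  · rintro ⟨u, hu, rfl⟩
    exact ⟨u * g⁻¹, mul_mem hu (inv_mem hg), by simp⟩

lemma mem_pairOrbit_self (m : ℕ) (a b : ℤ) : ({a, b} : Set ℤ) ∈ pairOrbit m (a, b) :=
  ⟨1, one_mem _, by simp⟩

lemma IsLPP.exists_abs_sub_le {m k : ℕ} (hm : 2 ≤ m) {S : Set ℤ} {f : ℤ → ℤ}
    (h : IsLPP m k S f) : ∃ M : ℤ, ∀ x ∈ S, |f x - x| ≤ M := by
  have hp : (0 : ℤ) < 2 * m - 2 := by omega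
  obtain ⟨M, hM⟩ := ((Set.finite_Ico (0 : ℤ) (2 * m - 2)).image fun x => |f x - x|).bddAbove
  refine ⟨M, fun x hx => ?_⟩
  obtain ⟨g, hg, hgx⟩ := exists_mem_Gm_apply_eq_add m (-(x / (2 * m - 2)))
  have hmod : g x = x % (2 * m - 2) := by rw [hgx, Int.emod_def]; ring
  have key := hM (Set.mem_image_of_mem _
    (⟨Int.emod_nonneg _ hp.ne', Int.emod_lt_of_pos _ hp⟩ : x % (2 * m - 2) ∈ Set.Ico 0 _))
  simp only [← hmod, h.equivariant g hg x hx] at key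
  rwa [hgx, hgx, add_sub_add_right_eq_sub] at key

lemma IsLPP.crossings_finite {m k : ℕ} (hm : 2 ≤ m) {S : Set ℤ} {f : ℤ → ℤ}
    (h : IsLPP m k S f) : (crossings m S f).Finite := by
  have hp : (0 : ℤ) < 2 * m - 2 := by omega
  obtain ⟨M, hM⟩ := h.exists_abs_sub_le hm
  refine (((Set.finite_Ico (0 : ℤ) (2 * m - 2)).prod
    (Set.finite_Ico (0 : ℤ) (2 * m - 2 + 2 * M))).image (pairOrbit m)).subset ?_
  rintro _ ⟨⟨a, b⟩, ⟨ha, hb, hab, hfab⟩, rfl⟩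
  obtain ⟨g, hg, hgx⟩ := exists_mem_Gm_apply_eq_add m (-(a / (2 * m - 2)))
  refine ⟨(g a, g b), ?_, pairOrbit_eq_of_mem hg a b⟩
  have hmod : g a = a % (2 * m - 2) := by rw [hgx, Int.emod_def]; ring
  have hdiff : g b - g a = b - a := by rw [hgx, hgx]; ring
  have h0 := Int.emod_nonneg a hp.ne'
  have h1 := Int.emod_lt_of_pos a hp
  have hMa := abs_le.mp (hM a ha)
  have hMb := abs_le.mp (hM b hb)
  simp only at hab hfab
  simp only [Set.mem_prod, Set.mem_Ico]
  omega

/-- The `G_m`-equivariant involution exchanging the orbits of `i` and `j` along `g i ↔ g j`. -/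
def orbitSwap (m : ℕ) (i j : ℤ) : ℤ → ℤ := resolveFun m id i j

section OrbitSwap

variable {m k : ℕ} {S : Set ℤ} {f : ℤ → ℤ} {i j : ℤ}

lemma orbitSwap_apply_left (i j : ℤ) {g : Equiv.Perm ℤ} (hg : g ∈ Gm m) :
    orbitSwap m i j (g i) = g j := by
  have hex : ∃ u ∈ Gm m, u i = g i := ⟨g, hg, rfl⟩
  have hch : hex.choose = g := Gm_eq_of_apply_eq hex.choose_spec.1 hg hex.choose_spec.2
  simp only [orbitSwap, resolveFun, dif_pos hex, hch, id]

lemma IsLPP.orbitSwap_apply_right (h : IsLPP m k S f) (hc : IsCrossing S f i j)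
    {g : Equiv.Perm ℤ} (hg : g ∈ Gm m) : orbitSwap m i j (g j) = g i := by
  obtain ⟨hi, hj, hij, hf⟩ := hc
  by_cases hex : ∃ u ∈ Gm m, u i = g j
  · obtain ⟨u, hu, hui⟩ := hex
    have hwG : g⁻¹ * u ∈ Gm m := mul_mem (inv_mem hg) hu
    have hwi : (g⁻¹ * u) i = j := by simp [hui]
    have hfj := h.equivariant _ hwG i hi
    rw [← hui, orbitSwap_apply_left i j hu]
    have hwj : (g⁻¹ * u) j = i := by
      rw [hwi] at hfj
      obtain ⟨t, ht | ht⟩ := Gm_classify hwG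
      · rw [ht] at hwi hfj
        omega
      · rw [ht] at hwi ⊢
        omega
    rwa [Equiv.Perm.mul_apply, Equiv.Perm.inv_eq_iff_eq] at hwj
  · have hex' : ∃ u ∈ Gm m, u j = g j := ⟨g, hg, rfl⟩
    have hch : hex'.choose = g := Gm_eq_of_apply_eq hex'.choose_spec.1 hg hex'.choose_spec.2
    simp only [orbitSwap, resolveFun, dif_neg hex, dif_pos hex', hch, id]

lemma orbitSwap_cases (m : ℕ) (i j x : ℤ) :
    (∃ g ∈ Gm m, g i = x) ∨ (∃ g ∈ Gm m, g j = x) ∨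
      ((¬ ∃ g ∈ Gm m, g i = x) ∧ (¬ ∃ g ∈ Gm m, g j = x) ∧ orbitSwap m i j x = x) := by
  by_cases h₁ : ∃ g ∈ Gm m, g i = x
  · exact Or.inl h₁
  by_cases h₂ : ∃ g ∈ Gm m, g j = x
  · exact Or.inr (Or.inl h₂)
  exact Or.inr (Or.inr ⟨h₁, h₂, by simp only [orbitSwap, resolveFun, dif_neg h₁, dif_neg h₂, id]⟩)

lemma IsLPP.orbitSwap_orbitSwap (h : IsLPP m k S f) (hc : IsCrossing S f i j) (x : ℤ) :
    orbitSwap m i j (orbitSwap m i j x) = x := by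
  rcases orbitSwap_cases m i j x with ⟨g, hg, rfl⟩ | ⟨g, hg, rfl⟩ | ⟨_, _, hx⟩
  · rw [orbitSwap_apply_left i j hg, h.orbitSwap_apply_right hc hg]
  · rw [h.orbitSwap_apply_right hc hg, orbitSwap_apply_left i j hg]
  · rw [hx, hx]

lemma IsLPP.orbitSwap_equivariant (h : IsLPP m k S f) (hc : IsCrossing S f i j)
    {g : Equiv.Perm ℤ} (hg : g ∈ Gm m) (x : ℤ) :
    orbitSwap m i j (g x) = g (orbitSwap m i j x) := by
  rcases orbitSwap_cases m i j x with ⟨u, hu, rfl⟩ | ⟨u, hu, rfl⟩ | ⟨hi, hj, hx⟩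
  · rw [orbitSwap_apply_left i j hu, ← Equiv.Perm.mul_apply,
      orbitSwap_apply_left i j (mul_mem hg hu), Equiv.Perm.mul_apply]
  · rw [h.orbitSwap_apply_right hc hu, ← Equiv.Perm.mul_apply,
      h.orbitSwap_apply_right hc (mul_mem hg hu), Equiv.Perm.mul_apply]
  · have back : ∀ y, (∃ u ∈ Gm m, u y = g x) → ∃ u ∈ Gm m, u y = x := by
      rintro y ⟨u, hu, huy⟩
      exact ⟨g⁻¹ * u, mul_mem (inv_mem hg) hu, by simp [huy]⟩
    rcases orbitSwap_cases m i j (g x) with hgx | hgx | ⟨_, _, hgx⟩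
    · exact absurd (back i hgx) hi
    · exact absurd (back j hgx) hj
    · rw [hgx, hx]

lemma IsLPP.orbitSwap_mem (h : IsLPP m k S f) (hc : IsCrossing S f i j) {x : ℤ} (hx : x ∈ S) :
    orbitSwap m i j x ∈ S := by
  rcases orbitSwap_cases m i j x with ⟨g, hg, rfl⟩ | ⟨g, hg, rfl⟩ | ⟨_, _, hx'⟩
  · rw [orbitSwap_apply_left i j hg]
    exact h.invariant g hg j hc.2.1
  · rw [h.orbitSwap_apply_right hc hg]
    exact h.invariant g hg i hc.1
  · rwa [hx']

/-- Points are moved by at most one fixed distance, and `f` moves in the opposite direction. -/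
lemma IsLPP.orbitSwap_displacement (h : IsLPP m k S f) (hc : IsCrossing S f i j) (x : ℤ) :
    (orbitSwap m i j x = x ∧ f (orbitSwap m i j x) = f x) ∨
      (orbitSwap m i j x = x + (j - i) ∧ f (orbitSwap m i j x) < f x) ∨
      (orbitSwap m i j x = x - (j - i) ∧ f x < f (orbitSwap m i j x)) := by
  obtain ⟨hi, hj, hij, hf⟩ := id hc
  rcases orbitSwap_cases m i j x with ⟨g, hg, rfl⟩ | ⟨g, hg, rfl⟩ | ⟨_, _, hx'⟩
  · rw [orbitSwap_apply_left i j hg, h.equivariant g hg i hi, h.equivariant g hg j hj]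
    obtain ⟨t, ht | ht⟩ := Gm_classify hg <;> simp only [ht] <;> omega
  · rw [h.orbitSwap_apply_right hc hg, h.equivariant g hg i hi, h.equivariant g hg j hj]
    obtain ⟨t, ht | ht⟩ := Gm_classify hg <;> simp only [ht] <;> omega
  · exact Or.inl ⟨hx', by rw [hx']⟩

lemma IsLPP.resolveFun_eq (h : IsLPP m k S f) (hc : IsCrossing S f i j) (x : ℤ) :
    resolveFun m f i j x = f (orbitSwap m i j x) := by
  by_cases h₁ : ∃ g ∈ Gm m, g i = x
  · simp only [orbitSwap, resolveFun, dif_pos h₁, id]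
    exact (h.equivariant _ h₁.choose_spec.1 j hc.2.1).symm
  by_cases h₂ : ∃ g ∈ Gm m, g j = x
  · simp only [orbitSwap, resolveFun, dif_neg h₁, dif_pos h₂, id]
    exact (h.equivariant _ h₂.choose_spec.1 i hc.1).symm
  · simp only [orbitSwap, resolveFun, dif_neg h₁, dif_neg h₂, id]

/-- Some pair in the class `C` has its order reversed by `orbitSwap m i j`. -/
def IsReversed (m : ℕ) (i j : ℤ) (C : Set (Set ℤ)) : Prop :=
  ∃ a b : ℤ, ({a, b} : Set ℤ) ∈ C ∧ a < b ∧ orbitSwap m i j b < orbitSwap m i j a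

lemma IsLPP.isReversed_pairOrbit_iff (h : IsLPP m k S f) (hc : IsCrossing S f i j) {a b : ℤ}
    (hab : a < b) :
    IsReversed m i j (pairOrbit m (a, b)) ↔ orbitSwap m i j b < orbitSwap m i j a := by
  refine ⟨?_, fun hr => ⟨a, b, mem_pairOrbit_self m a b, hab, hr⟩⟩
  rintro ⟨c, d, ⟨g, hg, hgcd⟩, hcd, hr⟩
  rcases Set.pair_eq_pair_iff.mp hgcd with ⟨rfl, rfl⟩ | ⟨rfl, rfl⟩ <;>
    rw [h.orbitSwap_equivariant hc hg, h.orbitSwap_equivariant hc hg] at hr <;>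
    obtain ⟨t, ht | ht⟩ := Gm_classify hg <;> simp only [ht] at hr hcd <;> omega

lemma IsLPP.image_orbitSwap_pairOrbit (h : IsLPP m k S f) (hc : IsCrossing S f i j) (a b : ℤ) :
    Set.image (orbitSwap m i j) '' pairOrbit m (a, b) =
      pairOrbit m (orbitSwap m i j a, orbitSwap m i j b) := by
  ext A
  constructor
  · rintro ⟨_, ⟨g, hg, rfl⟩, rfl⟩
    exact ⟨g, hg, by simp only [Set.image_pair, h.orbitSwap_equivariant hc hg]⟩
  · rintro ⟨g, hg, rfl⟩
    exact ⟨{g a, g b}, ⟨g, hg, rfl⟩, by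
      simp only [Set.image_pair, h.orbitSwap_equivariant hc hg]⟩

/-- The map from crossings of the resolution to crossings of `f`. -/
def crossingMap (m : ℕ) (i j : ℤ) (C : Set (Set ℤ)) : Set (Set ℤ) :=
  if IsReversed m i j C then C else Set.image (orbitSwap m i j) '' C

lemma IsLPP.isReversed_crossingMap_iff (h : IsLPP m k S f) (hc : IsCrossing S f i j)
    {C : Set (Set ℤ)} (hC : C ∈ crossings m S (resolveFun m f i j)) :
    IsReversed m i j (crossingMap m i j C) ↔ IsReversed m i j C := by
  by_cases hr : IsReversed m i j C
  · simp only [crossingMap, if_pos hr]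
  · simp only [crossingMap, hr, if_false, iff_false]
    obtain ⟨⟨a, b⟩, ⟨_, _, hab, hf⟩, rfl⟩ := hC
    simp only [h.resolveFun_eq hc] at hab hf
    rw [h.isReversed_pairOrbit_iff hc hab] at hr
    have hlt : orbitSwap m i j a < orbitSwap m i j b := by
      exact lt_of_le_of_ne (not_lt.mp hr) fun he => hf.ne' (congrArg f he)
    rw [h.image_orbitSwap_pairOrbit hc, h.isReversed_pairOrbit_iff hc hlt,
      h.orbitSwap_orbitSwap hc, h.orbitSwap_orbitSwap hc]
    omega

lemma IsLPP.injOn_crossingMap (h : IsLPP m k S f) (hc : IsCrossing S f i j) :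
    Set.InjOn (crossingMap m i j) (crossings m S (resolveFun m f i j)) := by
  intro C hC C' hC' heq
  have hiff := h.isReversed_crossingMap_iff hc hC
  rw [heq, h.isReversed_crossingMap_iff hc hC'] at hiff
  have hinj : Function.Injective (orbitSwap m i j) :=
    Function.LeftInverse.injective (h.orbitSwap_orbitSwap hc)
  by_cases hr : IsReversed m i j C
  · simpa only [crossingMap, if_pos hr, if_pos (hiff.mpr hr)] using heq
  · simp only [crossingMap, if_neg hr, if_neg (mt hiff.mp hr)] at heq
    exact hinj.image_injective.image_injective heq

lemma IsLPP.crossingMap_mem (h : IsLPP m k S f) (hc : IsCrossing S f i j)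
    {C : Set (Set ℤ)} (hC : C ∈ crossings m S (resolveFun m f i j)) :
    crossingMap m i j C ∈ crossings m S f \ {pairOrbit m (i, j)} := by
  have hiff := h.isReversed_crossingMap_iff hc hC
  have hi : orbitSwap m i j i = j := orbitSwap_apply_left i j (one_mem (Gm m))
  have hj : orbitSwap m i j j = i := h.orbitSwap_apply_right hc (one_mem (Gm m))
  have hrij : IsReversed m i j (pairOrbit m (i, j)) := by
    rw [h.isReversed_pairOrbit_iff hc hc.2.2.1, hi, hj]
    exact hc.2.2.1
  obtain ⟨⟨a, b⟩, ⟨ha, hb, hab, hf⟩, rfl⟩ := hC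
  simp only [h.resolveFun_eq hc] at ha hb hab hf
  by_cases hr : IsReversed m i j (pairOrbit m (a, b))
  · simp only [crossingMap, if_pos hr]
    constructor
    · rw [h.isReversed_pairOrbit_iff hc hab] at hr
      refine ⟨(a, b), ⟨ha, hb, hab, ?_⟩, rfl⟩
      have hij := hc.2.2.1
      simp only
      rcases h.orbitSwap_displacement hc a with h₁ | h₁ | h₁ <;>
        rcases h.orbitSwap_displacement hc b with h₂ | h₂ | h₂ <;>
        omega
    · intro hmem
      have hpair := mem_pairOrbit_self m a b
      rw [Set.mem_singleton_iff.mp hmem] at hpair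
      obtain ⟨g, hg, hgab⟩ := hpair
      obtain ⟨hiS, hjS, hij, hfij⟩ := id hc
      rcases Set.pair_eq_pair_iff.mp hgab with ⟨rfl, rfl⟩ | ⟨rfl, rfl⟩ <;>
        rw [orbitSwap_apply_left i j hg, h.orbitSwap_apply_right hc hg,
          h.equivariant g hg i hiS, h.equivariant g hg j hjS] at hf <;>
        obtain ⟨t, ht | ht⟩ := Gm_classify hg <;> simp only [ht] at hab hf <;> omega
  · refine ⟨?_, fun hmem => hr (hiff.mp (by rwa [Set.mem_singleton_iff.mp hmem]))⟩
    simp only [crossingMap, if_neg hr]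
    rw [h.isReversed_pairOrbit_iff hc hab] at hr
    refine ⟨(orbitSwap m i j a, orbitSwap m i j b),
      ⟨h.orbitSwap_mem hc ha, h.orbitSwap_mem hc hb, ?_, hf⟩,
      (h.image_orbitSwap_pairOrbit hc a b).symm⟩
    exact lt_of_le_of_ne (not_lt.mp hr) fun he => hf.ne' (congrArg f he)

end OrbitSwap

/-- Resolving a crossing drops the crossing number by at
least one: `cross(f_{⟨i,j⟩}) ≤ cross(f) − 1`. -/
theorem crossCount_resolve_le (m k : ℕ) (hm : 2 ≤ m) (hk0 : 0 < k) (hkm : k < m)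
    (S : Set ℤ) (f : ℤ → ℤ) (h : IsLPP m k S f)
    (i j : ℤ) (hc : IsCrossing S f i j) :
    crossCount m S (resolveFun m f i j) + 1 ≤ crossCount m S f := by
  have hfin := h.crossings_finite hm
  have hmem : pairOrbit m (i, j) ∈ crossings m S f := ⟨(i, j), hc, rfl⟩
  have hle := Set.ncard_le_ncard_of_injOn (crossingMap m i j)
    (fun C hC => h.crossingMap_mem hc hC) (h.injOn_crossingMap hc) hfin.sdiff
  calc crossCount m S (resolveFun m f i j) + 1
      ≤ (crossings m S f \ {pairOrbit m (i, j)}).ncard + 1 := Nat.add_le_add_right hle 1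
    _ = crossCount m S f := Set.ncard_sdiff_singleton_add_one hmem hfin
end
end

section
/- Let (S, f) and (T, g) be lifted partial permutations on k letters with T = f(S). If cross(g∘f) = cross(f) + cross(g), then w₁(S, g∘f) = w₁(S, f) + w₁(T, g) and w_m(S, g∘f) = w_m(S, f) + w_m(T, g). -/
open scoped Classical BigOperators

noncomputable section

lemma subLeft_one_mem_Gm (m : ℕ) : Equiv.subLeft (1 : ℤ) ∈ Gm m :=
  Subgroup.subset_closure (by simp)

lemma subLeft_two_mul_sub_one_mem_Gm (m : ℕ) : Equiv.subLeft (2 * (m : ℤ) - 1) ∈ Gm m :=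
  Subgroup.subset_closure (by simp)

/-- Elements of `G_m` are translations by multiples of `2m - 2` or reflections about
half-integers. -/
lemma apply_of_mem_Gm {m : ℕ} {h : Equiv.Perm ℤ} (hh : h ∈ Gm m) :
    ∃ t : ℤ, (∀ x, h x = x + (2 * m - 2) * t) ∨ (∀ x, h x = 1 - x + (2 * m - 2) * t) := by
  induction hh using Subgroup.closure_induction with
  | mem h hh =>
    rcases hh with rfl | rfl
    · exact ⟨0, Or.inr fun x => by simp⟩
    · exact ⟨1, Or.inr fun x => by simp only [Equiv.subLeft_apply]; ring⟩
  | one => exact ⟨0, Or.inl fun x => by simp⟩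
  | mul a b _ _ iha ihb =>
    obtain ⟨s, hs⟩ := iha
    obtain ⟨t, ht⟩ := ihb
    rcases hs with hs | hs <;> rcases ht with ht | ht
    · exact ⟨s + t, Or.inl fun x => by rw [Equiv.Perm.mul_apply, ht, hs]; ring⟩
    · exact ⟨s + t, Or.inr fun x => by rw [Equiv.Perm.mul_apply, ht, hs]; ring⟩
    · exact ⟨s - t, Or.inr fun x => by rw [Equiv.Perm.mul_apply, ht, hs]; ring⟩
    · exact ⟨s - t, Or.inl fun x => by rw [Equiv.Perm.mul_apply, ht, hs]; ring⟩
  | inv a _ iha =>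
    obtain ⟨s, hs | hs⟩ := iha
    · exact ⟨-s, Or.inl fun x => by rw [Equiv.Perm.inv_eq_iff_eq, hs]; ring⟩
    · exact ⟨s, Or.inr fun x => by rw [Equiv.Perm.inv_eq_iff_eq, hs]; ring⟩

/-- The action of `G_m` on `ℤ` is free. -/
lemma eq_one_of_mem_Gm_of_apply_eq {m : ℕ} {h : Equiv.Perm ℤ} (hh : h ∈ Gm m) {x : ℤ}
    (hx : h x = x) : h = 1 := by
  obtain ⟨t, ht | ht⟩ := apply_of_mem_Gm hh
  · have h0 : (2 * (m : ℤ) - 2) * t = 0 := by linarith [ht x]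
    ext y
    simp [ht y, h0]
  · have h1 := ht x
    have h2 : (2 * (m : ℤ) - 2) * t = 2 * ((m - 1) * t) := by ring
    omega

lemma addRight_mem_Gm (m : ℕ) (t : ℤ) : Equiv.addRight ((2 * (m : ℤ) - 2) * t) ∈ Gm m := by
  have h1 : Equiv.addRight (2 * (m : ℤ) - 2) ∈ Gm m := by
    convert mul_mem (subLeft_two_mul_sub_one_mem_Gm m) (subLeft_one_mem_Gm m) using 1
    ext x
    simp only [Equiv.coe_addRight, Equiv.Perm.mul_apply, Equiv.subLeft_apply]
    ring
  convert zpow_mem h1 t using 1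
  ext x
  simp [mul_comm]

lemma pairOrbit_apply {m : ℕ} {h : Equiv.Perm ℤ} (hh : h ∈ Gm m) (i j : ℤ) :
    pairOrbit m (h i, h j) = pairOrbit m (i, j) := by
  ext A
  constructor
  · rintro ⟨u, hu, rfl⟩
    exact ⟨u * h, mul_mem hu hh, rfl⟩
  · rintro ⟨u, hu, rfl⟩
    exact ⟨u * h⁻¹, mul_mem hu (inv_mem hh), by simp⟩

lemma pairOrbit_swap (m : ℕ) (i j : ℤ) : pairOrbit m (i, j) = pairOrbit m (j, i) := by
  simp only [pairOrbit, Set.pair_comm]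

lemma mem_weightSet {j : ℤ} {S : Set ℤ} {f : ℤ → ℤ} {i : ℤ} :
    i ∈ weightSet j S f ↔
      i ∈ S ∧ ((2 * i < 2 * j - 1 ∧ 2 * j - 1 < 2 * f i) ∨
        (2 * f i < 2 * j - 1 ∧ 2 * j - 1 < 2 * i)) := by
  have lt_iff (a : ℤ) : (a : ℚ) < (j : ℚ) - 1 / 2 ↔ 2 * a < 2 * j - 1 := by
    rw [← Int.cast_lt (R := ℚ)]
    push_cast
    constructor <;> intro h <;> linarith
  have gt_iff (a : ℤ) : (j : ℚ) - 1 / 2 < (a : ℚ) ↔ 2 * j - 1 < 2 * a := by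
    rw [← Int.cast_lt (R := ℚ)]
    push_cast
    constructor <;> intro h <;> linarith
  simp only [weightSet, Set.mem_ofPred_eq, lt_iff, gt_iff]

namespace IsLPP

variable {m k : ℕ} {S T : Set ℤ} {f g : ℤ → ℤ}

lemma injOn (hf : IsLPP m k S f) : Set.InjOn f S := by
  intro x hx y hy hxy
  obtain ⟨h, hh, rfl⟩ := hf.inj x hx y hy ⟨1, one_mem _, hxy⟩
  rw [hf.equivariant h hh x hx] at hxy
  rw [eq_one_of_mem_Gm_of_apply_eq hh hxy.symm]
  rfl

lemma exists_abs_sub_le_s7 (hf : IsLPP m k S f) (hm : 2 ≤ m) :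
    ∃ C : ℤ, ∀ x ∈ S, |f x - x| ≤ C := by
  refine ⟨∑ y ∈ Finset.Ico (0 : ℤ) (2 * m - 2), |f y - y|, fun x hx => ?_⟩
  have hN : (0 : ℤ) < 2 * m - 2 := by omega
  have key : f (x % (2 * m - 2)) - x % (2 * m - 2) = f x - x := by
    have h := hf.equivariant _ (addRight_mem_Gm m (-(x / (2 * m - 2)))) x hx
    simp only [Equiv.coe_addRight] at h
    have h' : x % (2 * m - 2) = x + (2 * m - 2) * -(x / (2 * m - 2)) := by
      rw [Int.emod_def]; ring
    rw [h', h]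
    ring
  rw [← key]
  exact Finset.single_le_sum (f := fun y => |f y - y|) (fun y _ => abs_nonneg _)
    (Finset.mem_Ico.2 ⟨Int.emod_nonneg _ hN.ne', Int.emod_lt_of_pos _ hN⟩)

lemma finite_crossings (hf : IsLPP m k S f) (hm : 2 ≤ m) : (crossings m S f).Finite := by
  obtain ⟨C, hC⟩ := hf.exists_abs_sub_le_s7 hm
  have hN : (0 : ℤ) < 2 * m - 2 := by omega
  refine (((Set.finite_Icc (0 : ℤ) (2 * m - 2)).prod
    (Set.finite_Icc (0 : ℤ) (2 * m - 2 + 2 * C))).image (pairOrbit m)).subset ?_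
  rintro _ ⟨⟨i, j⟩, ⟨hi, hj, hij, hfij⟩, rfl⟩
  dsimp only at hi hj hij hfij
  have hi' := abs_le.1 (hC i hi)
  have hj' := abs_le.1 (hC j hj)
  have h0 := Int.emod_nonneg i hN.ne'
  have h1 := Int.emod_lt_of_pos i hN
  have h2 := Int.emod_def i (2 * m - 2)
  refine ⟨(i + (2 * m - 2) * -(i / (2 * m - 2)), j + (2 * m - 2) * -(i / (2 * m - 2))), ?_,
    pairOrbit_apply (addRight_mem_Gm m (-(i / (2 * m - 2)))) i j⟩
  simp only [Set.mem_prod, Set.mem_Icc, mul_neg]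
  refine ⟨⟨?_, ?_⟩, ?_, ?_⟩ <;> linarith

lemma finite_weightSet (hf : IsLPP m k S f) (hm : 2 ≤ m) (j : ℤ) : (weightSet j S f).Finite := by
  obtain ⟨C, hC⟩ := hf.exists_abs_sub_le_s7 hm
  refine (Set.finite_Icc (j - C - 1) (j + C + 1)).subset fun i hi => ?_
  rw [mem_weightSet] at hi
  have h := abs_le.1 (hC i hi.1)
  rw [Set.mem_Icc]
  omega

/-- The class of a pair in `S` is recovered from the class of its image under `f`. -/
lemma setOf_image_mem_pairOrbit (hf : IsLPP m k S f) {i j : ℤ} (hi : i ∈ S) (hj : j ∈ S) :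
    {A | A ⊆ S ∧ f '' A ∈ pairOrbit m (f i, f j)} = pairOrbit m (i, j) := by
  have image_pair {h : Equiv.Perm ℤ} (hh : h ∈ Gm m) :
      f '' {h i, h j} = {h (f i), h (f j)} := by
    rw [Set.image_pair, hf.equivariant h hh i hi, hf.equivariant h hh j hj]
  have pair_subset {h : Equiv.Perm ℤ} (hh : h ∈ Gm m) : {h i, h j} ⊆ S :=
    Set.pair_subset (hf.invariant h hh i hi) (hf.invariant h hh j hj)
  ext A
  constructor
  · rintro ⟨hA, h, hh, hAh⟩
    refine ⟨h, hh, (hf.injOn.image_eq_image_iff hA (pair_subset hh)).1 ?_⟩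
    rw [hAh, image_pair hh]
  · rintro ⟨h, hh, rfl⟩
    exact ⟨pair_subset hh, h, hh, image_pair hh⟩

/-- If crossing numbers add under composition, then no pair crosses both in `f` and in `g`. -/
lemma not_lt_of_crossCount_comp (hm : 2 ≤ m) (hf : IsLPP m k S f) (hg : IsLPP m k T g)
    (hT : T = f '' S)
    (hcross : crossCount m S (g ∘ f) = crossCount m S f + crossCount m T g)
    {i j : ℤ} (hi : i ∈ S) (hj : j ∈ S) (hij : i < j) (hfij : f j < f i) :
    ¬ g (f i) < g (f j) := by
  intro hgij
  have hfT {x : ℤ} (hx : x ∈ S) : f x ∈ T := hT ▸ Set.mem_image_of_mem f hx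
  set A := crossings m S f
  set B := (fun O : Set (Set ℤ) => {A | A ⊆ S ∧ f '' A ∈ O}) '' crossings m T g
  have hA : A.Finite := hf.finite_crossings hm
  have hB : B.Finite := (hg.finite_crossings hm).image _
  have hBcard : B.ncard ≤ crossCount m T g := Set.ncard_image_le (hg.finite_crossings hm)
  have hsub : crossings m S (g ∘ f) ⊆ A ∪ B := by
    rintro _ ⟨⟨x, y⟩, ⟨hx, hy, hxy, hgf⟩, rfl⟩
    dsimp only [Function.comp_apply] at hx hy hxy hgf
    rcases lt_trichotomy (f x) (f y) with h | h | h
    · exact Or.inr ⟨_, ⟨(f x, f y), ⟨hfT hx, hfT hy, h, hgf⟩, rfl⟩,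
        hf.setOf_image_mem_pairOrbit hx hy⟩
    · rw [h] at hgf
      exact (lt_irrefl _ hgf).elim
    · exact Or.inl ⟨(x, y), ⟨hx, hy, hxy, h⟩, rfl⟩
  have hmem : pairOrbit m (i, j) ∈ A ∩ B := by
    refine ⟨⟨(i, j), ⟨hi, hj, hij, hfij⟩, rfl⟩, ?_⟩
    exact ⟨_, ⟨(f j, f i), ⟨hfT hj, hfT hi, hfij, hgij⟩, rfl⟩,
      (hf.setOf_image_mem_pairOrbit hj hi).trans (pairOrbit_swap m j i)⟩
  have hpos : 0 < (A ∩ B).ncard := (Set.ncard_pos (hA.subset Set.inter_subset_left)).2 ⟨_, hmem⟩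
  have hle := Set.ncard_le_ncard hsub (hA.union hB)
  have hunion := Set.ncard_union_add_ncard_inter A B hA hB
  change (crossings m S (g ∘ f)).ncard = A.ncard + _ at hcross
  omega

/-- If crossing numbers add under composition, then so do the weights at the walls of `G_m`. -/
lemma weight_comp (hm : 2 ≤ m) (hf : IsLPP m k S f) (hg : IsLPP m k T g) (hT : T = f '' S)
    (hcross : crossCount m S (g ∘ f) = crossCount m S f + crossCount m T g)
    {c : ℤ} (hc : Equiv.subLeft (2 * c - 1) ∈ Gm m) :
    weight c S (g ∘ f) = weight c S f + weight c T g := by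
  have hfT {x : ℤ} (hx : x ∈ S) : f x ∈ T := hT ▸ Set.mem_image_of_mem f hx
  have hdouble {i : ℤ} (hi : i ∈ S) : ¬ (i ∈ weightSet c S f ∧ f i ∈ weightSet c T g) := by
    simp only [mem_weightSet]
    have hi' := hf.invariant _ hc i hi
    have hfi := hf.equivariant _ hc i hi
    have hgi := hg.equivariant _ hc (f i) (hfT hi)
    have h1 := hf.not_lt_of_crossCount_comp hm hg hT hcross hi hi'
    have h2 := hf.not_lt_of_crossCount_comp hm hg hT hcross hi' hi
    rw [hfi, hgi] at h1 h2
    simp only [Equiv.subLeft_apply] at h1 h2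
    omega
  set B := S ∩ f ⁻¹' weightSet c T g
  have himage : f '' B = weightSet c T g := by
    rw [Set.image_inter_preimage, ← hT, Set.inter_eq_right]
    exact fun i hi => hi.1
  have hinj : Set.InjOn f B := hf.injOn.mono Set.inter_subset_left
  have hBcard : B.ncard = (weightSet c T g).ncard := by
    rw [← himage, hinj.ncard_image]
  have hB : B.Finite := Set.Finite.of_finite_image (himage ▸ hg.finite_weightSet hm c) hinj
  have hdisj : Disjoint (weightSet c S f) B :=
    Set.disjoint_left.2 fun i hi hiB => hdouble hiB.1 ⟨hi, hiB.2⟩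
  have hunion : weightSet c S (g ∘ f) = weightSet c S f ∪ B := by
    ext i
    by_cases hi : i ∈ S
    · have hd := hdouble hi
      simp only [B, Set.mem_union, Set.mem_inter_iff, Set.mem_preimage, mem_weightSet, hi, hfT hi,
        Function.comp_apply, true_and] at hd ⊢
      omega
    · simp [B, mem_weightSet, hi]
  simp only [weight]
  rw [hunion, Set.ncard_union_eq hdisj (hf.finite_weightSet hm c) hB, hBcard]
  push_cast
  ring

end IsLPP

/-- If `cross(g∘f) = cross(f) + cross(g)`, then the outermost
weights `w₁` and `w_m` add under composition. -/
theorem weight_outer_add (m k : ℕ) (hm : 2 ≤ m) (hk0 : 0 < k) (hkm : k < m)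
    (S : Set ℤ) (f : ℤ → ℤ) (T : Set ℤ) (g : ℤ → ℤ)
    (hf : IsLPP m k S f) (hg : IsLPP m k T g) (hT : T = f '' S)
    (hcross : crossCount m S (g ∘ f) = crossCount m S f + crossCount m T g) :
    weight 1 S (g ∘ f) = weight 1 S f + weight 1 T g ∧
      weight (m : ℤ) S (g ∘ f) = weight (m : ℤ) S f + weight (m : ℤ) T g := by
  exact ⟨hf.weight_comp hm hg hT hcross (subLeft_one_mem_Gm m),
    hf.weight_comp hm hg hT hcross (subLeft_two_mul_sub_one_mem_Gm m)⟩
end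
end
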